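/- Assume M is ∞-spanned and the indexing of the generators is adapted as in the Labelling lemma. Then the greatest common divisor of the set of lengths of all directed cycles in the shortlex automaton ShortLex equals 1; that is, gcd { l ≥ 1 : there exist a reachable non-fail state D and a word u of length l over {1, …, n} with all transitions defined and δ̂(D, u) = D } = 1 (in particular this set is nonempty). -/

import Mathlib

open scoped BigOperators

/-- The simple root `α_i`, the `i`-th standard basis vector of `ℝ^n`. -/
noncomputable def simpleRoot {n : ℕ} (i : Fin n) : Fin n → ℝ := Pi.single i 1

/-- The symmetric bilinear form `B` associated to the Coxeter matrix `M`, determined by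
`B(α_i, α_j) = -cos (π / M i j)` when `M i j ≠ 0` and `B(α_i, α_j) = -1` when
`M i j = 0` (the label `∞`). -/
noncomputable def bform {n : ℕ} (M : CoxeterMatrix (Fin n)) (u v : Fin n → ℝ) : ℝ :=
  ∑ i, ∑ j, u i * (if M i j = 0 then -1 else -Real.cos (Real.pi / (M i j))) * v j

/-- The simple reflection `σ_i(v) = v - 2 B(v, α_i) α_i`. -/
noncomputable def simpleRefl {n : ℕ} (M : CoxeterMatrix (Fin n)) (i : Fin n)
    (v : Fin n → ℝ) : Fin n → ℝ :=
  v - (2 * bform M v (simpleRoot i)) • simpleRoot i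

/-- The set `Σ` of small roots of `M`: the smallest set of vectors containing the simple
roots `α_1, …, α_n` and such that whenever `v ∈ Σ` and `-1 < B(v, α_i) < 0`, also
`σ_i(v) ∈ Σ`. -/
inductive IsSmallRoot {n : ℕ} (M : CoxeterMatrix (Fin n)) : (Fin n → ℝ) → Prop
  | simple (i : Fin n) : IsSmallRoot M (simpleRoot i)
  | reflect {v : Fin n → ℝ} (i : Fin n) : IsSmallRoot M v →
      -1 < bform M v (simpleRoot i) → bform M v (simpleRoot i) < 0 →
      IsSmallRoot M (simpleRefl M i v)

/-- The transition function of the geodesic automaton `Geo` (defined when `α_i ∉ D`):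
`δ(D, i) = {α_i} ∪ (σ_i(D) ∩ Σ)`. -/
noncomputable def stepGeo {n : ℕ} (M : CoxeterMatrix (Fin n)) (D : Set (Fin n → ℝ))
    (i : Fin n) : Set (Fin n → ℝ) :=
  insert (simpleRoot i) (simpleRefl M i '' D ∩ {v | IsSmallRoot M v})

/-- The transition function of the shortlex automaton `ShortLex` (defined when `α_i ∉ D`):
`δ(D, i) = {α_i} ∪ ((σ_i(D) ∪ {σ_i(α_l) : l < i}) ∩ Σ)`. -/
noncomputable def stepSL {n : ℕ} (M : CoxeterMatrix (Fin n)) (D : Set (Fin n → ℝ))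
    (i : Fin n) : Set (Fin n → ℝ) :=
  insert (simpleRoot i)
    ((simpleRefl M i '' D ∪ simpleRefl M i '' {v | ∃ l : Fin n, l < i ∧ v = simpleRoot l})
      ∩ {v | IsSmallRoot M v})

/-- All transitions of the automaton with transition function `step` are defined (do not
fail) when reading the word `u` from the state `D`; a transition out of `D` along the letter
`i` is defined exactly when `α_i ∉ D`. -/
def DefinedFrom {n : ℕ} (step : Set (Fin n → ℝ) → Fin n → Set (Fin n → ℝ)) :
    Set (Fin n → ℝ) → List (Fin n) → Prop
  | _, [] => True
  | D, i :: u => simpleRoot i ∉ D ∧ DefinedFrom step (step D i) u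

/-- The enhanced transition function `δ̂(D, u)`: the state obtained by reading the word `u`
from the state `D`. -/
def run {n : ℕ} (step : Set (Fin n → ℝ) → Fin n → Set (Fin n → ℝ))
    (D : Set (Fin n → ℝ)) (u : List (Fin n)) : Set (Fin n → ℝ) :=
  u.foldl step D

/-- A state is reachable if it is obtained from the start state `∅` by reading some word all
of whose transitions are defined. -/
def Reachable {n : ℕ} (step : Set (Fin n → ℝ) → Fin n → Set (Fin n → ℝ))
    (D : Set (Fin n → ℝ)) : Prop :=
  ∃ u : List (Fin n), DefinedFrom step ∅ u ∧ run step ∅ u = D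

/-- The graph of `∞`-edges of the Coxeter matrix `M`: `i ≠ j` are adjacent iff `M i j = 0`. -/
def infGraph {n : ℕ} (M : CoxeterMatrix (Fin n)) : SimpleGraph (Fin n) :=
  SimpleGraph.fromRel (fun i j => M i j = 0)

/-- The indexing of the generators is adapted as in the Labelling lemma: there is a spanning
tree `Γ` of the graph of `∞`-edges containing the edges `{1,2}` and `{2,3}`, such that along
every simple path in `Γ` from the vertex `1` to a leaf of `Γ` the labels strictly increase.
(Vertices `1, 2, 3` correspond to the indices `0, 1, 2` of `Fin n`.) -/
def AdaptedLabelling {n : ℕ} (hn : 3 ≤ n) (M : CoxeterMatrix (Fin n)) : Prop :=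
  ∃ Γ : SimpleGraph (Fin n), Γ ≤ infGraph M ∧ Γ.Connected ∧ Γ.IsAcyclic ∧
    Γ.Adj ⟨0, by omega⟩ ⟨1, by omega⟩ ∧ Γ.Adj ⟨1, by omega⟩ ⟨2, by omega⟩ ∧
    ∀ (v : Fin n) (p : Γ.Walk ⟨0, by omega⟩ v), p.IsPath → (∃! w : Fin n, Γ.Adj v w) →
      p.support.Chain' (· < ·)

/-- The coefficient `B(α_i, α_j)` of the bilinear form. -/
noncomputable def rootCoeff {n : ℕ} (M : CoxeterMatrix (Fin n)) (i j : Fin n) : ℝ :=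
  if M i j = 0 then -1 else -Real.cos (Real.pi / (M i j))

theorem bform_simpleRoot {n : ℕ} (M : CoxeterMatrix (Fin n)) (v : Fin n → ℝ) (i : Fin n) :
    bform M v (simpleRoot i) = ∑ k, v k * rootCoeff M k i := by
  simp [bform, simpleRoot, rootCoeff, Pi.single_apply]

theorem simpleRefl_apply_of_ne {n : ℕ} (M : CoxeterMatrix (Fin n)) {i k : Fin n} (hk : k ≠ i)
    (v : Fin n → ℝ) : simpleRefl M i v k = v k := by
  simp [simpleRefl, simpleRoot, hk]

theorem simpleRefl_apply_self {n : ℕ} (M : CoxeterMatrix (Fin n)) (i : Fin n)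
    (v : Fin n → ℝ) : simpleRefl M i v i = v i - 2 * bform M v (simpleRoot i) := by
  simp [simpleRefl, simpleRoot]

/-- Off the diagonal the coefficients of the form are either `0` or at most `-1/2`. -/
theorem rootCoeff_eq_zero_or_le {n : ℕ} (M : CoxeterMatrix (Fin n)) {i j : Fin n} (h : i ≠ j) :
    rootCoeff M i j = 0 ∨ rootCoeff M i j ≤ -(1 / 2) := by
  unfold rootCoeff
  split_ifs with h0
  · right; norm_num
  · have h1 : M i j ≠ 1 := M.off_diagonal i j h
    rcases (by omega : M i j = 2 ∨ 3 ≤ M i j) with h2 | h3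
    · left; simp [h2]
    · right
      have h3' : (3 : ℝ) ≤ M i j := by exact_mod_cast h3
      have hle : Real.pi / (M i j) ≤ Real.pi / 3 := by gcongr
      have hcos := Real.cos_le_cos_of_nonneg_of_le_pi (x := Real.pi / (M i j))
        (y := Real.pi / 3) (by positivity) (by linarith [Real.pi_pos]) hle
      rw [Real.cos_pi_div_three] at hcos
      linarith

theorem rootCoeff_nonpos {n : ℕ} (M : CoxeterMatrix (Fin n)) {i j : Fin n} (h : i ≠ j) :
    rootCoeff M i j ≤ 0 := by
  rcases rootCoeff_eq_zero_or_le M h with h | h <;> linarith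

theorem bform_simpleRoot_le {n : ℕ} (M : CoxeterMatrix (Fin n)) {v : Fin n → ℝ}
    (hv : ∀ k, v k = 0 ∨ 1 ≤ v k) {i : Fin n} (hi : v i = 0) (j : Fin n) :
    bform M v (simpleRoot i) ≤ v j * rootCoeff M j i := by
  rw [bform_simpleRoot, ← Finset.add_sum_erase _ _ (Finset.mem_univ j)]
  have : ∑ k ∈ Finset.univ.erase j, v k * rootCoeff M k i ≤ 0 := by
    refine Finset.sum_nonpos fun k _ => ?_
    by_cases hk : k = i
    · simp [hk, hi]
    · refine mul_nonpos_of_nonneg_of_nonpos ?_ (rootCoeff_nonpos M hk)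
      rcases hv k with h | h <;> linarith
  linarith

/-- If `i` is outside the support of `v` and joined to it by an `∞`-edge, then
`B(v, α_i) ≤ -1`. -/
theorem bform_simpleRoot_le_neg_one {n : ℕ} (M : CoxeterMatrix (Fin n)) {v : Fin n → ℝ}
    (hv : ∀ k, v k = 0 ∨ 1 ≤ v k) {i j : Fin n} (hi : v i = 0) (hj : v j ≠ 0)
    (hij : M i j = 0) : bform M v (simpleRoot i) ≤ -1 := by
  have h := bform_simpleRoot_le M hv hi j
  rw [rootCoeff, if_pos (by rwa [M.symmetric])] at h
  have := (hv j).resolve_left hj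
  linarith

theorem IsSmallRoot.coeff_zero_or_one_le {n : ℕ} {M : CoxeterMatrix (Fin n)} {v : Fin n → ℝ}
    (hv : IsSmallRoot M v) (k : Fin n) : v k = 0 ∨ 1 ≤ v k := by
  induction hv generalizing k with
  | simple i =>
    by_cases h : k = i <;> simp [simpleRoot, h]
  | @reflect v i _ _ hneg ih =>
    by_cases hk : k = i
    · subst hk
      right
      rw [simpleRefl_apply_self]
      rcases ih k with h0 | h1
      · obtain ⟨j, hj⟩ : ∃ j, v j * rootCoeff M j k < 0 := by
          by_contra! hcon
          rw [bform_simpleRoot] at hneg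
          exact absurd (Finset.sum_nonneg fun j _ => hcon j) (not_le.mpr hneg)
        have hjk : j ≠ k := by
          rintro rfl
          simp [h0] at hj
        have hle := bform_simpleRoot_le M ih h0 j
        rcases ih j with hj0 | hj1
        · simp [hj0] at hj
        rcases rootCoeff_eq_zero_or_le M hjk with hc | hc
        · simp [hc] at hj
        nlinarith
      · linarith
    · rw [simpleRefl_apply_of_ne M hk]
      exact ih k

/-- The support of a small root contains no `∞`-edge. -/
theorem IsSmallRoot.label_ne_zero {n : ℕ} {M : CoxeterMatrix (Fin n)} {v : Fin n → ℝ}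
    (hv : IsSmallRoot M v) {i j : Fin n} (hi : v i ≠ 0) (hj : v j ≠ 0) : M i j ≠ 0 := by
  induction hv generalizing i j with
  | simple l =>
    have key : ∀ k, simpleRoot l k ≠ 0 → k = l := fun k hk => by
      by_contra h
      simp [simpleRoot, h] at hk
    rw [key i hi, key j hj, M.diagonal]
    exact one_ne_zero
  | @reflect v l hv hgt _ ih =>
    have new : ∀ k, k ≠ l → v k ≠ 0 → M l k ≠ 0 := fun k _ hk hlk => by
      by_cases hl : v l = 0
      · linarith [bform_simpleRoot_le_neg_one M hv.coeff_zero_or_one_le hl hk hlk]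
      · exact ih hl hk hlk
    by_cases hil : i = l <;> by_cases hjl : j = l
    · rw [hil, hjl, M.diagonal]
      exact one_ne_zero
    · rw [simpleRefl_apply_of_ne M hjl] at hj
      rw [hil]
      exact new j hjl hj
    · rw [simpleRefl_apply_of_ne M hil] at hi
      rw [hjl, M.symmetric]
      exact new i hil hi
    · rw [simpleRefl_apply_of_ne M hil] at hi
      rw [simpleRefl_apply_of_ne M hjl] at hj
      exact ih hi hj

theorem IsSmallRoot.exists_ne_zero {n : ℕ} {M : CoxeterMatrix (Fin n)} {v : Fin n → ℝ}
    (hv : IsSmallRoot M v) : ∃ k, v k ≠ 0 := by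
  induction hv with
  | simple i => exact ⟨i, by simp [simpleRoot]⟩
  | @reflect v i _ _ hneg ih =>
    by_contra! hcon
    have hzero : ∀ k, k ≠ i → v k = 0 := fun k hk => by
      rw [← simpleRefl_apply_of_ne M hk v, hcon k]
    have hb : bform M v (simpleRoot i) = v i := by
      rw [bform_simpleRoot, Finset.sum_eq_single i (fun k _ hk => by simp [hzero k hk])
        (by simp)]
      simp [rootCoeff]
    have := hcon i
    rw [simpleRefl_apply_self, hb] at this
    linarith

/-- If `v` and `σ_i(v)` are both small roots, their supports avoid all `∞`-neighbours of `i`. -/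
theorem IsSmallRoot.simpleRefl_apply_eq_zero {n : ℕ} {M : CoxeterMatrix (Fin n)}
    {v : Fin n → ℝ} (hv : IsSmallRoot M v) {i j : Fin n} (hr : IsSmallRoot M (simpleRefl M i v))
    (hij : M i j = 0) : simpleRefl M i v j = 0 := by
  by_contra hj
  have hji : j ≠ i := by
    rintro rfl
    simp at hij
  have hvj : v j ≠ 0 := by rwa [simpleRefl_apply_of_ne M hji] at hj
  have hri : simpleRefl M i v i = 0 := by
    by_contra hi
    exact hr.label_ne_zero hi hj hij
  have hvi : v i = 0 := by
    by_contra hi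
    exact hv.label_ne_zero hi hvj hij
  have := bform_simpleRoot_le_neg_one M hv.coeff_zero_or_one_le hvi hvj hij
  rw [simpleRefl_apply_self] at hri
  linarith

/-- `D` consists of small roots whose supports avoid the `∞`-neighbours of `i`. -/
def AvoidsNeighbors {n : ℕ} (M : CoxeterMatrix (Fin n)) (i : Fin n)
    (D : Set (Fin n → ℝ)) : Prop :=
  ∀ v ∈ D, IsSmallRoot M v ∧ ∀ j, M i j = 0 → v j = 0

theorem avoidsNeighbors_stepSL {n : ℕ} {M : CoxeterMatrix (Fin n)} {D : Set (Fin n → ℝ)}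
    (hD : ∀ v ∈ D, IsSmallRoot M v) (i : Fin n) : AvoidsNeighbors M i (stepSL M D i) := by
  rintro v (rfl | ⟨⟨w, hw, rfl⟩ | ⟨w, ⟨l, _, rfl⟩, rfl⟩, hs⟩)
  · refine ⟨.simple i, fun j hj => ?_⟩
    have hji : j ≠ i := by
      rintro rfl
      simp at hj
    simp [simpleRoot, hji]
  · exact ⟨hs, fun j hj => (hD w hw).simpleRefl_apply_eq_zero hs hj⟩
  · exact ⟨hs, fun j hj => (IsSmallRoot.simple l).simpleRefl_apply_eq_zero hs hj⟩

theorem AvoidsNeighbors.simpleRoot_notMem {n : ℕ} {M : CoxeterMatrix (Fin n)}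
    {D : Set (Fin n → ℝ)} {i j : Fin n} (hD : AvoidsNeighbors M i D) (hij : M i j = 0) :
    simpleRoot j ∉ D := fun h => by
  simpa [simpleRoot] using (hD _ h).2 j hij

theorem label_eq_zero_of_infGraph_adj {n : ℕ} {M : CoxeterMatrix (Fin n)} {i j : Fin n}
    (h : (infGraph M).Adj i j) : M i j = 0 := by
  rcases h.2 with h | h
  · exact h
  · rwa [M.symmetric]

/-- Every walk along `∞`-edges is accepted by the shortlex automaton. -/
theorem AvoidsNeighbors.definedFrom_walk {n : ℕ} {M : CoxeterMatrix (Fin n)} {i j : Fin n}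
    (p : (infGraph M).Walk i j) {D : Set (Fin n → ℝ)} (hD : AvoidsNeighbors M i D) :
    DefinedFrom (stepSL M) D p.support.tail ∧
      AvoidsNeighbors M j (run (stepSL M) D p.support.tail) := by
  induction p generalizing D with
  | nil => exact ⟨trivial, hD⟩
  | cons h p ih =>
    have := ih (avoidsNeighbors_stepSL (fun v hv => (hD v hv).1) _)
    rw [SimpleGraph.Walk.support_cons, List.tail_cons, ← SimpleGraph.Walk.cons_tail_support]
    exact ⟨⟨hD.simpleRoot_notMem (label_eq_zero_of_infGraph_adj h), this.1⟩, this.2⟩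

/-- The small roots obtained by reflecting the elements of `D` in `α_i`. -/
noncomputable def reflectSmall {n : ℕ} (M : CoxeterMatrix (Fin n)) (D : Set (Fin n → ℝ))
    (i : Fin n) : Set (Fin n → ℝ) :=
  simpleRefl M i '' D ∩ {v | IsSmallRoot M v}

theorem stepSL_union {n : ℕ} (M : CoxeterMatrix (Fin n)) (A D : Set (Fin n → ℝ)) (i : Fin n) :
    stepSL M (A ∪ D) i = stepSL M A i ∪ reflectSmall M D i := by
  ext v
  simp only [stepSL, reflectSmall, Set.image_union, Set.mem_insert_iff, Set.mem_inter_iff,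
    Set.mem_union]
  tauto

theorem run_stepSL_union {n : ℕ} (M : CoxeterMatrix (Fin n)) (A D : Set (Fin n → ℝ))
    (u : List (Fin n)) :
    run (stepSL M) (A ∪ D) u = run (stepSL M) A u ∪ run (reflectSmall M) D u := by
  induction u generalizing A D with
  | nil => rfl
  | cons i u ih =>
    simp only [run, List.foldl_cons, stepSL_union] at ih ⊢
    exact ih _ _

theorem run_append {n : ℕ} (step : Set (Fin n → ℝ) → Fin n → Set (Fin n → ℝ))
    (D : Set (Fin n → ℝ)) (u w : List (Fin n)) :
    run step D (u ++ w) = run step (run step D u) w :=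
  List.foldl_append

/-- Along a walk of `∞`-edges, the surviving reflected roots lose every visited coordinate
except possibly the last one. -/
theorem run_reflectSmall_walk {n : ℕ} {M : CoxeterMatrix (Fin n)} {i j : Fin n}
    (p : (infGraph M).Walk i j) {D : Set (Fin n → ℝ)} {A : Set (Fin n)}
    (hD : ∀ v ∈ D, IsSmallRoot M v ∧ ∀ k ∈ A, k ≠ i → v k = 0) :
    ∀ v ∈ run (reflectSmall M) D p.support.tail,
      IsSmallRoot M v ∧ ∀ k, k ∈ A ∨ k ∈ p.support → k ≠ j → v k = 0 := by
  induction p generalizing D A with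
  | nil =>
    intro v hv
    refine ⟨(hD v hv).1, fun k hk hne => ?_⟩
    rcases hk with hk | hk
    · exact (hD v hv).2 k hk hne
    · simp at hk
      exact absurd hk hne
  | @cons i l j h p ih =>
    have hstep : ∀ v ∈ reflectSmall M D l,
        IsSmallRoot M v ∧ ∀ k ∈ insert i A, k ≠ l → v k = 0 := by
      rintro v ⟨⟨w, hw, rfl⟩, hs⟩
      refine ⟨hs, fun k hk hkl => ?_⟩
      by_cases hki : k = i
      · exact (hD w hw).1.simpleRefl_apply_eq_zero hs
          (by rw [hki]; exact label_eq_zero_of_infGraph_adj h.symm)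
      · rw [simpleRefl_apply_of_ne M hkl]
        exact (hD w hw).2 k (hk.resolve_left hki) hki
    rw [SimpleGraph.Walk.support_cons, List.tail_cons, ← SimpleGraph.Walk.cons_tail_support]
    intro v hv
    obtain ⟨hs, hzero⟩ := ih hstep v hv
    refine ⟨hs, fun k hk => hzero k ?_⟩
    rw [SimpleGraph.Walk.cons_tail_support, List.mem_cons] at hk
    rw [Set.mem_insert_iff]
    tauto

/-- No small root supported at `i` alone survives an `∞`-edge out of `i`. -/
theorem reflectSmall_eq_empty {n : ℕ} {M : CoxeterMatrix (Fin n)} {i j : Fin n}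
    (hij : (infGraph M).Adj i j) {D : Set (Fin n → ℝ)}
    (hD : ∀ v ∈ D, IsSmallRoot M v ∧ ∀ k, k ≠ i → v k = 0) : reflectSmall M D j = ∅ := by
  rw [Set.eq_empty_iff_forall_notMem]
  rintro v ⟨⟨w, hw, rfl⟩, hs⟩
  obtain ⟨hw, hzero⟩ := hD w hw
  obtain ⟨k, hk⟩ := hw.exists_ne_zero
  have hki : k = i := by
    by_contra h
    exact hk (hzero k h)
  subst hki
  rw [← simpleRefl_apply_of_ne M hij.ne w] at hk
  exact hk (hw.simpleRefl_apply_eq_zero hs (label_eq_zero_of_infGraph_adj hij.symm))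

theorem run_reflectSmall_empty {n : ℕ} (M : CoxeterMatrix (Fin n)) (u : List (Fin n)) :
    run (reflectSmall M) ∅ u = ∅ := by
  induction u with
  | nil => rfl
  | cons i u ih =>
    have h : reflectSmall M ∅ i = ∅ := by simp [reflectSmall]
    simpa [run, h] using ih

theorem SimpleGraph.Connected.exists_closed_walk_covering {V : Type*} [Fintype V]
    {G : SimpleGraph V} (hG : G.Connected) (a : V) : ∃ p : G.Walk a a, ∀ v, v ∈ p.support := by
  classical
  suffices h : ∀ s : Finset V, ∃ p : G.Walk a a, ∀ v ∈ s, v ∈ p.support by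
    obtain ⟨p, hp⟩ := h Finset.univ
    exact ⟨p, fun v => hp v (Finset.mem_univ v)⟩
  intro s
  induction s using Finset.induction_on with
  | empty => exact ⟨.nil, by simp⟩
  | insert b s _ ih =>
    obtain ⟨p, hp⟩ := ih
    obtain ⟨q⟩ := hG.preconnected a b
    refine ⟨p.append (q.append q.reverse), fun v hv => ?_⟩
    rw [SimpleGraph.Walk.mem_support_append_iff, SimpleGraph.Walk.mem_support_append_iff]
    rcases Finset.mem_insert.mp hv with rfl | hv
    · exact Or.inr (Or.inl q.end_mem_support)
    · exact Or.inl (hp v hv)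

/-- There is a closed walk of `∞`-edges whose word sends all sets of small roots to the
same state. -/
theorem exists_synchronizing_walk {n : ℕ} {M : CoxeterMatrix (Fin n)}
    (hspan : (infGraph M).Connected) {a b : Fin n} (hab : (infGraph M).Adj a b) :
    ∃ p : (infGraph M).Walk a a, 1 ≤ p.length ∧ ∀ D : Set (Fin n → ℝ),
      (∀ v ∈ D, IsSmallRoot M v) →
        run (stepSL M) D p.support.tail = run (stepSL M) ∅ p.support.tail := by
  obtain ⟨c, hc⟩ := hspan.exists_closed_walk_covering a
  refine ⟨c.append (.cons hab (.cons hab.symm .nil)), by simp, fun D hD => ?_⟩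
  have htail : (c.append (.cons hab (.cons hab.symm .nil))).support.tail =
      c.support.tail ++ (b :: [a]) := by
    rw [SimpleGraph.Walk.tail_support_append]
    simp
  have hsurv := run_reflectSmall_walk c (D := D) (A := ∅) (fun v hv => ⟨hD v hv, by simp⟩)
  have hkill := reflectSmall_eq_empty hab
    (fun v hv => ⟨(hsurv v hv).1, fun k hk => (hsurv v hv).2 k (Or.inr (hc k)) hk⟩)
  have hempty : run (reflectSmall M) D (c.support.tail ++ (b :: [a])) = ∅ := by
    rw [run_append]
    change run (reflectSmall M) (reflectSmall M _ b) [a] = ∅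
    rw [hkill, run_reflectSmall_empty]
  rw [htail]
  conv_lhs => rw [← Set.empty_union D, run_stepSL_union, hempty, Set.union_empty]

theorem definedFrom_append {n : ℕ} {step : Set (Fin n → ℝ) → Fin n → Set (Fin n → ℝ)}
    {D : Set (Fin n → ℝ)} {u w : List (Fin n)} (hu : DefinedFrom step D u)
    (hw : DefinedFrom step (run step D u) w) : DefinedFrom step D (u ++ w) := by
  induction u generalizing D with
  | nil => exact hw
  | cons i u ih => exact ⟨hu.1, ih hu.2 hw⟩

/-- If `a` is the least generator and `b` is joined to `a` and `c` by `∞`-edges, the word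
`a c b` can be read from any state reached by the letter `b`. -/
theorem AvoidsNeighbors.definedFrom_triangle {n : ℕ} {M : CoxeterMatrix (Fin n)}
    {a b c : Fin n} (ha : ∀ l, ¬ l < a) (hba : M b a = 0) (hbc : M b c = 0) (hca : c ≠ a)
    {D : Set (Fin n → ℝ)} (hD : AvoidsNeighbors M b D) :
    DefinedFrom (stepSL M) D [a, c, b] ∧
      AvoidsNeighbors M b (run (stepSL M) D [a, c, b]) := by
  have h₁ := avoidsNeighbors_stepSL (fun v hv => (hD v hv).1) a
  have h₂ := avoidsNeighbors_stepSL (fun v hv => (h₁ v hv).1) c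
  have h₃ := avoidsNeighbors_stepSL (fun v hv => (h₂ v hv).1) b
  refine ⟨⟨hD.simpleRoot_notMem hba, ?_, h₂.simpleRoot_notMem (by rwa [M.symmetric]), trivial⟩,
    h₃⟩
  rintro (h | ⟨⟨w, hw, h⟩ | ⟨w, ⟨l, hl, _⟩, _⟩, _⟩)
  · simpa [simpleRoot, hca] using congrFun h c
  · have hc := congrFun h c
    rw [simpleRefl_apply_of_ne M hca, (hD w hw).2 c hbc] at hc
    simp [simpleRoot] at hc
  · exact ha l hl

/-- **GCD lemma** for the shortlex automaton: if `M` is `∞`-spanned and the indexing is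
adapted as in the Labelling lemma, then the set of lengths of directed cycles of the
automaton (through reachable non-fail states) is nonempty and its greatest common divisor is
`1`, i.e. the only natural number dividing all cycle lengths is `1`. -/
theorem gcd_cycles_shortlex {n : ℕ} (hn : 3 ≤ n) (M : CoxeterMatrix (Fin n))
    (hspan : (infGraph M).Connected) (hadapt : AdaptedLabelling hn M) :
    {l : ℕ | 1 ≤ l ∧ ∃ (D : Set (Fin n → ℝ)) (u : List (Fin n)),
        Reachable (stepSL M) D ∧ u.length = l ∧ DefinedFrom (stepSL M) D u ∧
        run (stepSL M) D u = D}.Nonempty ∧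
    ∀ d : ℕ, (∀ l ∈ {l : ℕ | 1 ≤ l ∧ ∃ (D : Set (Fin n → ℝ)) (u : List (Fin n)),
        Reachable (stepSL M) D ∧ u.length = l ∧ DefinedFrom (stepSL M) D u ∧
        run (stepSL M) D u = D}, d ∣ l) → d = 1 := by
  obtain ⟨Γ, hΓ, -, -, h01, h12, -⟩ := hadapt
  replace h01 := hΓ h01
  replace h12 := hΓ h12
  obtain ⟨p, hlen, hsync⟩ := exists_synchronizing_walk hspan h01.symm
  set w := p.support.tail with hw
  set D := run (stepSL M) ∅ w with hDdef
  have hwlen : w.length = p.length := by simp [hw]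
  obtain ⟨hdef, hD⟩ := AvoidsNeighbors.definedFrom_walk p (D := ∅) (by simp [AvoidsNeighbors])
  have cycle : ∀ x : List (Fin n), DefinedFrom (stepSL M) D x →
      AvoidsNeighbors M ⟨1, by omega⟩ (run (stepSL M) D x) →
      x.length + p.length ∈ {l : ℕ | 1 ≤ l ∧ ∃ (D : Set (Fin n → ℝ)) (u : List (Fin n)),
        Reachable (stepSL M) D ∧ u.length = l ∧ DefinedFrom (stepSL M) D u ∧
        run (stepSL M) D u = D} := fun x hx hav =>
    ⟨by omega, D, x ++ w, ⟨w, hdef, rfl⟩, by simp [hwlen],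
      definedFrom_append hx (hav.definedFrom_walk p).1,
      by rw [run_append, hsync _ fun v hv => (hav v hv).1]⟩
  have c0 := cycle [] trivial hD
  have back := hD.definedFrom_walk (.cons h01.symm (.cons h01 .nil))
  have c2 := cycle [_, _] back.1 back.2
  have tri := hD.definedFrom_triangle (a := ⟨0, by omega⟩) (c := ⟨2, by omega⟩)
    (fun l hl => Nat.not_lt_zero _ hl) (label_eq_zero_of_infGraph_adj h01.symm)
    (label_eq_zero_of_infGraph_adj h12) (by simp)
  have c3 := cycle _ tri.1 tri.2
  refine ⟨⟨_, c0⟩, fun d hd => ?_⟩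
  have d2 := hd _ c2
  have d3 := hd _ c3
  simp only [List.length_cons, List.length_nil] at d2 d3
  have := (Nat.dvd_sub d3 d2)
  rwa [show 0 + 1 + 1 + 1 + p.length - (0 + 1 + 1 + p.length) = 1 by omega,
    Nat.dvd_one] at this
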